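/- arXiv:2410.17447 — 2 statements merged into one kernel-verified Lean document; each statement's English description precedes it below -/
import Mathlib

section
/- Fix z > 1, m ∈ {1,…,k} and x_0,…,x_m ∈ (0,1). In the compound negative-binomial construction with parameter z, E[x_m^{T_m} Π_{i=0}^{m-1} x_i^{Σ_{j=1}^{T_m} N_{i,j}^{(m)}}] = H_m(x_0,…,x_m,z)^{−(1+δ)/b_m}, where the functions H_m are defined recursively by H_1(x_0,x_1,z) = (1−x_1)z^{b_1/b_0} + x_1(x_0+z(1−x_0))^{b_1/b_0} and H_m(x_0,…,x_m,z) = (1−x_m)z^{b_m/b_0} + x_m H_{m-1}(x_0,…,x_{m-1},z)^{b_m/b_{m-1}} for m = 2,…,k. -/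
open MeasureTheory Filter Finset

noncomputable section

/-- The coefficient `b_m = k - m + 1 + δ(k - m)`. -/
def bcoef (k : ℕ) (δ : ℝ) (m : ℕ) : ℝ := (k : ℝ) - m + 1 + δ * ((k : ℝ) - m)

/-- The coefficient `τ = k + 2 + δ(k + 1)`. -/
def tauc (k : ℕ) (δ : ℝ) : ℝ := (k : ℝ) + 2 + δ * ((k : ℝ) + 1)

/-- The negative binomial pmf with shape `r` and success probability `a`. -/
def nbWeight (r a : ℝ) (ℓ : ℕ) : ℝ :=
  Real.Gamma ((ℓ : ℝ) + r) / ((ℓ.factorial : ℝ) * Real.Gamma r) * (1 - a) ^ ℓ * a ^ r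

/-- The extended truncated negative binomial pmf with parameters `κ` and `a`. -/
def tnbWeight (κ a : ℝ) (ℓ : ℕ) : ℝ :=
  if ℓ = 0 then 0
  else κ * Real.Gamma ((ℓ : ℝ) - κ) / ((ℓ.factorial : ℝ) * Real.Gamma (1 - κ))
    * (1 - a) ^ ℓ / (1 - a ^ κ)

/-- The measure on `ℕ` with mass function `f`. -/
def natMeasure (f : ℕ → ℝ) : Measure ℕ :=
  Measure.sum fun ℓ => ENNReal.ofReal (f ℓ) • Measure.dirac ℓ

/-- `ℓ`-fold convolution power of a measure on `Fin m → ℕ`, i.e. the law of a sum of `ℓ`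
i.i.d. vectors of law `ν`. -/
def convPow {m : ℕ} (ν : Measure (Fin m → ℕ)) : ℕ → Measure (Fin m → ℕ)
  | 0 => Measure.dirac 0
  | ℓ + 1 => (ν.prod (convPow ν ℓ)).map fun p => p.1 + p.2

/-- The law of the random vector `(N_0^{(m)}, …, N_{m-1}^{(m)})` from the compound
negative-binomial construction with parameter `z`: the last coordinate `N_{m-1}^{(m)}` is
extended truncated negative binomial with parameters `b_m / b_{m-1}` and `z^{-b_{m-1}/b_0}`,
and conditionally on `N_{m-1}^{(m)} = ℓ` the first `m - 1` coordinates form the sum of `ℓ`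
i.i.d. copies of `(N_0^{(m-1)}, …, N_{m-2}^{(m-1)})`. -/
def vecLaw (k : ℕ) (δ : ℝ) (z : ℝ) : (m : ℕ) → Measure (Fin m → ℕ)
  | 0 => Measure.dirac 0
  | m + 1 =>
    (natMeasure (tnbWeight (bcoef k δ (m + 1) / bcoef k δ m)
        (z ^ (-(bcoef k δ m / bcoef k δ 0))))).bind
      fun ℓ => (convPow (vecLaw k δ z m) ℓ).map fun v => Fin.snoc v ℓ

/-- The joint law of `(T_m, Σ_{j=1}^{T_m} (N_{0,j}^{(m)}, …, N_{m-1,j}^{(m)}))`, where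
`T_m` is negative binomial with shape `(1+δ)/b_m` and success probability `z^{-b_m/b_0}`,
and the summands are i.i.d. copies of `(N_0^{(m)}, …, N_{m-1}^{(m)})` independent of `T_m`. -/
def pairLaw (k : ℕ) (δ : ℝ) (z : ℝ) (m : ℕ) : Measure (ℕ × (Fin m → ℕ)) :=
  (natMeasure (nbWeight ((1 + δ) / bcoef k δ m) (z ^ (-(bcoef k δ m / bcoef k δ 0))))).bind
    fun t => (convPow (vecLaw k δ z m) t).map fun v => (t, v)

/-- The joint law of the independent family
`((T_m, Σ_{j=1}^{T_m} N_{·,j}^{(m)}))_{m = 0, …, k}` given `z`. -/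
def jointLaw (k : ℕ) (δ : ℝ) (z : ℝ) :
    Measure (∀ m : Fin (k + 1), ℕ × (Fin (m : ℕ) → ℕ)) :=
  Measure.pi fun m => pairLaw k δ z (m : ℕ)

/-- Assembles the degree vector: coordinate `i` is
`k - i + 1 + T_i + Σ_{m=i+1}^{k} Σ_{j=1}^{T_m} N_{i,j}^{(m)}`. -/
def assembleD (k : ℕ) (x : ∀ m : Fin (k + 1), ℕ × (Fin (m : ℕ) → ℕ)) : Fin (k + 1) → ℕ :=
  fun i => (k - (i : ℕ) + 1) + (x i).1 +
    ∑ m : Fin (k + 1), if h : (i : ℕ) < (m : ℕ) then (x m).2 ⟨(i : ℕ), h⟩ else 0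

/-- Given `z`, the conditional law of the random degree vector
`(k - i + 1 + T_i + Σ_{m=i+1}^{k} Σ_{j=1}^{T_m} N_{i,j}^{(m)})_{i = 0, …, k}`. -/
def Dlaw (k : ℕ) (δ : ℝ) (z : ℝ) : Measure (Fin (k + 1) → ℕ) :=
  (jointLaw k δ z).map (assembleD k)

/-- The functions `H_m` of display (4.4) in the paper (with `H_0(x_0,z) = x_0 + z(1-x_0)`). -/
def Hfun (k : ℕ) (δ : ℝ) (x : ℕ → ℝ) (z : ℝ) : ℕ → ℝ
  | 0 => x 0 + z * (1 - x 0)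
  | m + 1 => (1 - x (m + 1)) * z ^ (bcoef k δ (m + 1) / bcoef k δ 0)
      + x (m + 1) * Hfun k δ x z m ^ (bcoef k δ (m + 1) / bcoef k δ m)

/-- The functions `g_m`: `g_0(θ_0) = 1 + θ_0`,
`g_{m+1}(θ_0,…,θ_{m+1}) = g_m(θ_0,…,θ_m)^{b_{m+1}/b_m} + θ_{m+1}`. -/
def gfun (k : ℕ) (δ : ℝ) (θ : ℕ → ℝ) : ℕ → ℝ
  | 0 => 1 + θ 0
  | m + 1 => gfun k δ θ m ^ (bcoef k δ (m + 1) / bcoef k δ m) + θ (m + 1)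

/-- Gamma function values at shifts by natural numbers, through generalized binomial
coefficients. -/
theorem Real.Gamma_nat_add_eq_choose_mul {r : ℝ} (hr : ∀ m : ℕ, r ≠ -m) (n : ℕ) :
    Real.Gamma (n + r) = n.factorial * Ring.choose (r + n - 1) n * Real.Gamma r := by
  induction n with
  | zero => simp
  | succ n ih =>
    have hstep : Real.Gamma ((n + 1 : ℕ) + r) = (n + r) * Real.Gamma (n + r) := by
      rw [← Real.Gamma_add_one (by have := hr n; grind)]
      congr 1
      push_cast
      ring
    have hn := Ring.factorial_nsmul_multichoose_eq_ascPochhammer r n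
    have hsucc := Ring.factorial_nsmul_multichoose_eq_ascPochhammer r (n + 1)
    rw [nsmul_eq_mul] at hn hsucc
    rw [hstep, ih, ← Ring.multichoose_eq, ← Ring.multichoose_eq, hn, hsucc,
      ascPochhammer_succ_right, Polynomial.smeval_mul, Polynomial.smeval_add,
      Polynomial.smeval_natCast]
    simp
    ring

theorem Real.hasSum_choose_mul_pow (r : ℝ) {u : ℝ} (hu : |u| < 1) :
    HasSum (fun n : ℕ => Ring.choose (r + n - 1) n * u ^ n) ((1 - u) ^ (-r)) := by
  have h := (Real.one_div_one_sub_rpow_hasFPowerSeriesOnBall_zero r).hasSum (y := u)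
    (by simpa [enorm_eq_nnnorm, ← NNReal.coe_lt_coe] using hu)
  rw [Real.rpow_neg (by linarith [le_abs_self u])]
  simpa [FormalMultilinearSeries.ofScalars_apply_eq, mul_comm] using h

theorem abs_one_sub_mul_lt_one {a s : ℝ} (ha : a ∈ Set.Ioo (0 : ℝ) 1)
    (hs : s ∈ Set.Icc (0 : ℝ) 1) : |(1 - a) * s| < 1 := by
  obtain ⟨ha0, ha1⟩ := ha
  obtain ⟨hs0, hs1⟩ := hs
  rw [abs_of_nonneg (mul_nonneg (by linarith) hs0)]
  nlinarith

/-- The probability generating function of the negative binomial law. -/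
theorem hasSum_nbWeight_mul_pow {r a s : ℝ} (hr : 0 < r) (ha : a ∈ Set.Ioo (0 : ℝ) 1)
    (hs : s ∈ Set.Icc (0 : ℝ) 1) :
    HasSum (fun ℓ => nbWeight r a ℓ * s ^ ℓ) ((1 - (1 - a) * s) ^ (-r) * a ^ r) := by
  refine ((Real.hasSum_choose_mul_pow r (abs_one_sub_mul_lt_one ha hs)).mul_right
    (a ^ r)).congr_fun fun ℓ => ?_
  have hΓ := (Real.Gamma_pos_of_pos hr).ne'
  have hfac : (ℓ.factorial : ℝ) ≠ 0 := by positivity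
  rw [nbWeight, Real.Gamma_nat_add_eq_choose_mul fun m => by
    have : (0 : ℝ) ≤ m := m.cast_nonneg
    linarith, mul_pow]
  field_simp

/-- The probability generating function of the extended truncated negative binomial law. -/
theorem hasSum_tnbWeight_mul_pow {κ a s : ℝ} (hκ : κ ∈ Set.Ioo (0 : ℝ) 1)
    (ha : a ∈ Set.Ioo (0 : ℝ) 1) (hs : s ∈ Set.Icc (0 : ℝ) 1) :
    HasSum (fun ℓ => tnbWeight κ a ℓ * s ^ ℓ)
      ((1 - (1 - (1 - a) * s) ^ κ) / (1 - a ^ κ)) := by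
  obtain ⟨hκ0, hκ1⟩ := hκ
  have h := ((hasSum_ite_eq (0 : ℕ) (1 : ℝ)).sub
    (Real.hasSum_choose_mul_pow (-κ) (abs_one_sub_mul_lt_one ha hs))).div_const (1 - a ^ κ)
  rw [neg_neg] at h
  refine h.congr_fun fun ℓ => ?_
  rcases eq_or_ne ℓ 0 with rfl | hℓ
  · simp [tnbWeight]
  have hκnat : ∀ m : ℕ, -κ ≠ -m := by
    intro m hm
    rw [neg_inj] at hm
    rw [hm] at hκ0 hκ1
    norm_cast at hκ0 hκ1
    omega
  have hshift : Real.Gamma (1 - κ) = -κ * Real.Gamma (-κ) := by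
    rw [← Real.Gamma_add_one (by linarith)]
    congr 1
    ring
  have hΓ : Real.Gamma (-κ) ≠ 0 := Real.Gamma_ne_zero hκnat
  have hfac : (ℓ.factorial : ℝ) ≠ 0 := by positivity
  rw [tnbWeight, if_neg hℓ, if_neg hℓ, hshift, sub_eq_add_neg (ℓ : ℝ),
    Real.Gamma_nat_add_eq_choose_mul hκnat, mul_pow]
  field_simp
  ring

theorem nbWeight_nonneg {r a : ℝ} (hr : 0 < r) (ha : a ∈ Set.Ioo (0 : ℝ) 1) (ℓ : ℕ) :
    0 ≤ nbWeight r a ℓ := by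
  have ha0 := ha.1
  have ha1 : 0 ≤ 1 - a := by linarith [ha.2]
  have := Real.Gamma_pos_of_pos hr
  have := Real.Gamma_pos_of_pos (show 0 < (ℓ : ℝ) + r by positivity)
  unfold nbWeight
  positivity

theorem tnbWeight_nonneg {κ a : ℝ} (hκ : κ ∈ Set.Ioo (0 : ℝ) 1) (ha : a ∈ Set.Ioo (0 : ℝ) 1)
    (ℓ : ℕ) : 0 ≤ tnbWeight κ a ℓ := by
  unfold tnbWeight
  split_ifs with hℓ
  · exact le_rfl
  have hℓ1 : (1 : ℝ) ≤ ℓ := by exact_mod_cast Nat.one_le_iff_ne_zero.2 hℓ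
  have hκ0 := hκ.1
  have hκ1 := hκ.2
  have ha1 : 0 ≤ 1 - a := by linarith [ha.2]
  have := Real.Gamma_pos_of_pos (show 0 < 1 - κ by linarith)
  have := Real.Gamma_pos_of_pos (show 0 < (ℓ : ℝ) - κ by linarith)
  have : 0 ≤ 1 - a ^ κ := by linarith [Real.rpow_lt_one ha.1.le ha.2 hκ0]
  positivity

theorem lintegral_natMeasure (f : ℕ → ℝ) (g : ℕ → ENNReal) :
    ∫⁻ ℓ, g ℓ ∂(natMeasure f) = ∑' ℓ, ENNReal.ofReal (f ℓ) * g ℓ := by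
  simp [natMeasure, lintegral_sum_measure]

theorem lintegral_pow_natMeasure {f : ℕ → ℝ} (hf : ∀ ℓ, 0 ≤ f ℓ) {s S : ℝ} (hs : 0 ≤ s)
    (h : HasSum (fun ℓ => f ℓ * s ^ ℓ) S) :
    ∫⁻ ℓ, ENNReal.ofReal s ^ ℓ ∂(natMeasure f) = ENNReal.ofReal S := by
  rw [lintegral_natMeasure, ← h.tsum_eq,
    ENNReal.ofReal_tsum_of_nonneg (fun ℓ => mul_nonneg (hf ℓ) (pow_nonneg hs ℓ)) h.summable]
  exact tsum_congr fun ℓ => by rw [ENNReal.ofReal_mul (hf ℓ), ENNReal.ofReal_pow hs]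

/-- The monomial `∏ i, x i ^ v i` with values in the extended nonnegative reals. -/
def monomialWeight (x : ℕ → ℝ) {m : ℕ} (v : Fin m → ℕ) : ENNReal :=
  ∏ i : Fin m, ENNReal.ofReal (x i) ^ v i

theorem monomialWeight_add (x : ℕ → ℝ) {m : ℕ} (v w : Fin m → ℕ) :
    monomialWeight x (v + w) = monomialWeight x v * monomialWeight x w := by
  simp [monomialWeight, pow_add, Finset.prod_mul_distrib]

theorem monomialWeight_snoc (x : ℕ → ℝ) {m : ℕ} (v : Fin m → ℕ) (ℓ : ℕ) :
    monomialWeight x (Fin.snoc v ℓ : Fin (m + 1) → ℕ)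
      = monomialWeight x v * ENNReal.ofReal (x m) ^ ℓ := by
  simp [monomialWeight, Fin.prod_univ_castSucc]

theorem lintegral_monomialWeight_convPow (x : ℕ → ℝ) {m : ℕ} (ν : Measure (Fin m → ℕ)) (ℓ : ℕ) :
    ∫⁻ v, monomialWeight x v ∂(convPow ν ℓ) = (∫⁻ v, monomialWeight x v ∂ν) ^ ℓ := by
  induction ℓ with
  | zero => simp [convPow, monomialWeight]
  | succ ℓ ih =>
    rw [convPow, lintegral_map .of_discrete .of_discrete]
    simp_rw [monomialWeight_add]
    rw [lintegral_prod_mul Measurable.of_discrete.aemeasurable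
      Measurable.of_discrete.aemeasurable, ih, pow_succ']

theorem lintegral_monomialWeight_vecLaw_succ (k : ℕ) (δ z : ℝ) (x : ℕ → ℝ) (m : ℕ) :
    ∫⁻ v, monomialWeight x v ∂(vecLaw k δ z (m + 1))
      = ∫⁻ ℓ, (ENNReal.ofReal (x m) * ∫⁻ v, monomialWeight x v ∂(vecLaw k δ z m)) ^ ℓ
        ∂(natMeasure (tnbWeight (bcoef k δ (m + 1) / bcoef k δ m)
          (z ^ (-(bcoef k δ m / bcoef k δ 0))))) := by
  rw [vecLaw, Measure.lintegral_bind Measurable.of_discrete.aemeasurable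
    Measurable.of_discrete.aemeasurable]
  refine lintegral_congr fun ℓ => ?_
  rw [lintegral_map .of_discrete .of_discrete]
  simp_rw [monomialWeight_snoc]
  rw [lintegral_mul_const _ .of_discrete, lintegral_monomialWeight_convPow, mul_pow, mul_comm]

theorem lintegral_monomialWeight_pairLaw (k : ℕ) (δ z : ℝ) (x : ℕ → ℝ) (m : ℕ) :
    ∫⁻ y, ENNReal.ofReal (x m) ^ y.1 * monomialWeight x y.2 ∂(pairLaw k δ z m)
      = ∫⁻ t, (ENNReal.ofReal (x m) * ∫⁻ v, monomialWeight x v ∂(vecLaw k δ z m)) ^ t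
        ∂(natMeasure (nbWeight ((1 + δ) / bcoef k δ m)
          (z ^ (-(bcoef k δ m / bcoef k δ 0))))) := by
  rw [pairLaw, Measure.lintegral_bind Measurable.of_discrete.aemeasurable
    Measurable.of_discrete.aemeasurable]
  refine lintegral_congr fun t => ?_
  rw [lintegral_map .of_discrete .of_discrete]
  dsimp only
  rw [lintegral_const_mul _ .of_discrete, lintegral_monomialWeight_convPow, mul_pow]

theorem bcoef_pos {k : ℕ} {δ : ℝ} (hδ : -1 < δ) {m : ℕ} (hmk : m ≤ k) : 0 < bcoef k δ m := by
  have : (m : ℝ) ≤ k := by exact_mod_cast hmk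
  unfold bcoef
  nlinarith

theorem bcoef_succ_lt {k : ℕ} {δ : ℝ} (hδ : -1 < δ) (m : ℕ) :
    bcoef k δ (m + 1) < bcoef k δ m := by
  unfold bcoef
  push_cast
  linarith

theorem bcoef_succ_div_mem_Ioo {k : ℕ} {δ : ℝ} (hδ : -1 < δ) {m : ℕ} (hmk : m + 1 ≤ k) :
    bcoef k δ (m + 1) / bcoef k δ m ∈ Set.Ioo (0 : ℝ) 1 := by
  have hm : 0 < bcoef k δ m := bcoef_pos hδ (by omega)
  exact ⟨div_pos (bcoef_pos hδ hmk) hm, (div_lt_one hm).2 (bcoef_succ_lt hδ m)⟩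

theorem bcoef_div_zero_pos {k : ℕ} {δ : ℝ} (hδ : -1 < δ) {m : ℕ} (hmk : m ≤ k) :
    0 < bcoef k δ m / bcoef k δ 0 :=
  div_pos (bcoef_pos hδ hmk) (bcoef_pos hδ (Nat.zero_le k))

theorem rpow_neg_bcoef_div_mem_Ioo {k : ℕ} {δ z : ℝ} (hδ : -1 < δ) (hz : 1 < z) {m : ℕ}
    (hmk : m ≤ k) : z ^ (-(bcoef k δ m / bcoef k δ 0)) ∈ Set.Ioo (0 : ℝ) 1 :=
  ⟨by positivity,
    Real.rpow_lt_one_of_one_lt_of_neg hz (neg_neg_of_pos (bcoef_div_zero_pos hδ hmk))⟩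

theorem rpow_bcoef_div_rpow {k : ℕ} {δ z : ℝ} (hδ : -1 < δ) (hz : 1 < z) {m : ℕ} (hmk : m ≤ k) :
    (z ^ (bcoef k δ m / bcoef k δ 0)) ^ (bcoef k δ (m + 1) / bcoef k δ m)
      = z ^ (bcoef k δ (m + 1) / bcoef k δ 0) := by
  rw [← Real.rpow_mul (by linarith)]
  congr 1
  have := bcoef_pos hδ hmk
  field_simp

theorem Hfun_rpow_mem_Icc {k : ℕ} {δ z : ℝ} (hδ : -1 < δ) (hz : 1 < z) {x : ℕ → ℝ} {m : ℕ}
    (hmk : m + 1 ≤ k)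
    (hH : Hfun k δ x z m ∈ Set.Icc 1 (z ^ (bcoef k δ m / bcoef k δ 0))) :
    Hfun k δ x z m ^ (bcoef k δ (m + 1) / bcoef k δ m)
      ∈ Set.Icc 1 (z ^ (bcoef k δ (m + 1) / bcoef k δ 0)) := by
  have hκ := (bcoef_succ_div_mem_Ioo hδ hmk).1.le
  refine ⟨Real.one_le_rpow hH.1 hκ, ?_⟩
  rw [← rpow_bcoef_div_rpow hδ hz (by omega)]
  exact Real.rpow_le_rpow (by linarith [hH.1]) hH.2 hκ

theorem Hfun_mem_Icc {k : ℕ} {δ z : ℝ} (hδ : -1 < δ) (hz : 1 < z) {x : ℕ → ℝ} {m : ℕ}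
    (hmk : m ≤ k) (hx : ∀ i, i ≤ m → x i ∈ Set.Ioo (0 : ℝ) 1) :
    Hfun k δ x z m ∈ Set.Icc 1 (z ^ (bcoef k δ m / bcoef k δ 0)) := by
  induction m with
  | zero =>
    obtain ⟨h0, h1⟩ := hx 0 le_rfl
    rw [div_self (bcoef_pos hδ hmk).ne', Real.rpow_one, Hfun]
    constructor <;> nlinarith
  | succ m ih =>
    obtain ⟨h0, h1⟩ := hx (m + 1) le_rfl
    obtain ⟨hl, hu⟩ := Hfun_rpow_mem_Icc hδ hz hmk
      (ih (by omega) fun i hi => hx i (by omega))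
    rw [Hfun]
    constructor <;> nlinarith

/-- The generating function of `vecLaw` at `(x_0, …, x_{m-1})` is a number `p ∈ [0, 1]` that
determines `H_m` as a function of `x_m`. -/
theorem exists_lintegral_monomialWeight_vecLaw {k : ℕ} {δ z : ℝ} (hδ : -1 < δ) (hz : 1 < z)
    {x : ℕ → ℝ} {m : ℕ} (hmk : m ≤ k) (hx : ∀ i, i ≤ m → x i ∈ Set.Ioo (0 : ℝ) 1) :
    ∃ p ∈ Set.Icc (0 : ℝ) 1,
      ∫⁻ v, monomialWeight x v ∂(vecLaw k δ z m) = ENNReal.ofReal p ∧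
      1 - (1 - z ^ (-(bcoef k δ m / bcoef k δ 0))) * (x m * p)
        = z ^ (-(bcoef k δ m / bcoef k δ 0)) * Hfun k δ x z m := by
  induction m with
  | zero =>
    refine ⟨1, by simp, by simp [vecLaw, monomialWeight], ?_⟩
    rw [div_self (bcoef_pos hδ hmk).ne', Real.rpow_neg_one, Hfun]
    field_simp
    ring
  | succ m ih =>
    have hx' : ∀ i, i ≤ m → x i ∈ Set.Ioo (0 : ℝ) 1 := fun i hi => hx i (by omega)
    have hmk' : m ≤ k := by omega
    obtain ⟨p, ⟨hp0, hp1⟩, hp, hH⟩ := ih hmk' hx'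
    obtain ⟨hxm0, hxm1⟩ := hx m (by omega)
    have hs : x m * p ∈ Set.Icc (0 : ℝ) 1 := ⟨by positivity, by nlinarith⟩
    have hκ := bcoef_succ_div_mem_Ioo hδ hmk
    have ha := rpow_neg_bcoef_div_mem_Ioo hδ hz hmk'
    have hHm := Hfun_mem_Icc hδ hz hmk' hx'
    obtain ⟨hl, hu⟩ := Hfun_rpow_mem_Icc hδ hz hmk hHm
    have hsum := hasSum_tnbWeight_mul_pow hκ ha hs
    have hc := Real.one_lt_rpow hz (bcoef_div_zero_pos hδ hmk)
    have hpow := rpow_bcoef_div_rpow hδ hz hmk'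
    rw [hH, Real.mul_rpow ha.1.le (by linarith [hHm.1]), Real.rpow_neg (by linarith),
      Real.inv_rpow (by positivity), hpow] at hsum
    refine ⟨(1 - (z ^ (bcoef k δ (m + 1) / bcoef k δ 0))⁻¹ *
      Hfun k δ x z m ^ (bcoef k δ (m + 1) / bcoef k δ m)) /
        (1 - (z ^ (bcoef k δ (m + 1) / bcoef k δ 0))⁻¹), ?_, ?_, ?_⟩
    rotate_left
    · rw [lintegral_monomialWeight_vecLaw_succ, hp, ← ENNReal.ofReal_mul hxm0.le]
      refine lintegral_pow_natMeasure (tnbWeight_nonneg hκ ha) hs.1 ?_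
      rw [Real.rpow_neg (by linarith)]
      exact hsum
    · rw [Real.rpow_neg (by linarith), Hfun]
      generalize z ^ (bcoef k δ (m + 1) / bcoef k δ 0) = c at *
      generalize Hfun k δ x z m ^ (bcoef k δ (m + 1) / bcoef k δ m) = h at *
      have hc1 : c - 1 ≠ 0 := by linarith
      field_simp
      ring
    · generalize z ^ (bcoef k δ (m + 1) / bcoef k δ 0) = c at *
      generalize Hfun k δ x z m ^ (bcoef k δ (m + 1) / bcoef k δ m) = h at *
      have hc0 : 0 < 1 - c⁻¹ := by linarith [inv_lt_one_of_one_lt₀ hc]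
      have hci : 0 < c⁻¹ := by positivity
      refine ⟨div_nonneg ?_ hc0.le, (div_le_one hc0).2 ?_⟩
      · have : c⁻¹ * c = 1 := inv_mul_cancel₀ (by linarith)
        nlinarith
      · nlinarith

/-- The joint probability generating function of `T_m` and the compound sums
`Σ_{j=1}^{T_m} N_{i,j}^{(m)}`, `i = 0, …, m-1`:
`E[x_m^{T_m} Π_{i=0}^{m-1} x_i^{Σ_j N_{i,j}^{(m)}}] = H_m(x_0,…,x_m,z)^{-(1+δ)/b_m}`. -/
theorem pair_pgf_eq_Hfun (k : ℕ) (δ : ℝ) (hδ : -1 < δ) (z : ℝ) (hz : 1 < z)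
    (m : ℕ) (hm1 : 1 ≤ m) (hmk : m ≤ k) (x : ℕ → ℝ)
    (hx : ∀ i, i ≤ m → x i ∈ Set.Ioo (0 : ℝ) 1) :
    (∫ y, x m ^ y.1 * ∏ i : Fin m, x (i : ℕ) ^ y.2 i ∂(pairLaw k δ z m))
      = Hfun k δ x z m ^ (-((1 + δ) / bcoef k δ m)) := by
  obtain ⟨p, ⟨hp0, hp1⟩, hp, hH⟩ := exists_lintegral_monomialWeight_vecLaw hδ hz hmk hx
  obtain ⟨hxm0, hxm1⟩ := hx m le_rfl
  have hs : x m * p ∈ Set.Icc (0 : ℝ) 1 := ⟨by positivity, by nlinarith⟩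
  have hr : 0 < (1 + δ) / bcoef k δ m := div_pos (by linarith) (bcoef_pos hδ hmk)
  have ha := rpow_neg_bcoef_div_mem_Ioo hδ hz hmk
  have hHm : 0 ≤ Hfun k δ x z m := by linarith [(Hfun_mem_Icc hδ hz hmk hx).1]
  have hsum := hasSum_nbWeight_mul_pow hr ha hs
  rw [hH, Real.mul_rpow ha.1.le hHm, mul_right_comm, ← Real.rpow_add ha.1, neg_add_cancel,
    Real.rpow_zero, one_mul] at hsum
  have hx0 : ∀ i : Fin m, 0 ≤ x i := fun i => (hx i i.2.le).1.le
  rw [integral_eq_lintegral_of_nonneg_ae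
    (.of_forall fun y => mul_nonneg (pow_nonneg hxm0.le _)
      (Finset.prod_nonneg fun i _ => pow_nonneg (hx0 i) _))
    Measurable.of_discrete.aestronglyMeasurable]
  have hfun : ∀ y : ℕ × (Fin m → ℕ),
      ENNReal.ofReal (x m ^ y.1 * ∏ i : Fin m, x (i : ℕ) ^ y.2 i)
        = ENNReal.ofReal (x m) ^ y.1 * monomialWeight x y.2 := fun y => by
    rw [ENNReal.ofReal_mul (pow_nonneg hxm0.le _), ENNReal.ofReal_pow hxm0.le,
      ENNReal.ofReal_prod_of_nonneg fun i _ => pow_nonneg (hx0 i) _, monomialWeight]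
    simp_rw [ENNReal.ofReal_pow (hx0 _)]
  simp_rw [hfun]
  rw [lintegral_monomialWeight_pairLaw, hp, ← ENNReal.ofReal_mul hxm0.le,
    lintegral_pow_natMeasure (nbWeight_nonneg hr ha) hs.1 hsum,
    ENNReal.toReal_ofReal (Real.rpow_nonneg hHm _)]
end
end

section
/- Fix an integer k ≥ 0 and real δ > -1, and set a_0 := (k+1)(1+δ)/b_0. Let (p̃^{(0)}_i)_{i≥k+1} be the unique solution of the recursion p̃^{(0)}_i = (((i−k−1)b_0+δ)/((i−k)b_0+(k+2)(1+δ))) p̃^{(0)}_{i−1} + (τ/(b_0+(k+2)(1+δ))) 1{i = k+1} for i ≥ k+1 (with p̃^{(0)}_k := 0). Then for every i ≥ k+1, (Γ(i−k−1+a_0)/((i−k−1)! Γ(a_0))) ∫_1^∞ (1−z^{−1})^{i−k−1} z^{−a_0} (τ/b_0) z^{−(1+τ/b_0)} dz = p̃^{(0)}_i; that is, p̃^{(0)}_i is the pmf of k+1 plus a negative binomial random variable with shape a_0 and random success probability Z^{−1}, where Z has density (τ/b_0) z^{−(1+τ/b_0)}, z ≥ 1. Explicitly, p̃^{(0)}_i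 = (τ/b_0)(Γ(a_0+τ/b_0)/Γ(a_0))(Γ(i−k−1+a_0)/Γ(i−k+a_0+τ/b_0)). -/
open MeasureTheory Filter Finset

noncomputable section

/-- The recursion for the limiting marginal pmf `(p̃^{(0)}_i)_{i ≥ k+1}` of the top degree. -/
def MarginalRec (k : ℕ) (δ : ℝ) (q : ℕ → ℝ) : Prop :=
  q k = 0 ∧
  ∀ i : ℕ, k + 1 ≤ i →
    q i = (((i : ℝ) - k - 1) * bcoef k δ 0 + δ) /
        (((i : ℝ) - k) * bcoef k δ 0 + ((k : ℝ) + 2) * (1 + δ)) * q (i - 1)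
      + tauc k δ / (bcoef k δ 0 + ((k : ℝ) + 2) * (1 + δ)) * (if i = k + 1 then 1 else 0)

/-- The shape parameter `a_0 = (k+1)(1+δ)/b_0`. -/
def a0c (k : ℕ) (δ : ℝ) : ℝ := ((k : ℝ) + 1) * (1 + δ) / bcoef k δ 0

/-- The Beta integral `∫_1^∞ (1 - z⁻¹)^n z^{-(1+c)} dz = n! Γ(c) / Γ(n + 1 + c)`, together with
the integrability of its integrand. -/
theorem integrableOn_and_integral_one_sub_inv_pow_mul_rpow (n : ℕ) {c : ℝ} (hc : 0 < c) :
    IntegrableOn (fun z : ℝ => (1 - z⁻¹) ^ n * z ^ (-(1 + c))) (Set.Ioi 1) ∧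
      ∫ z in Set.Ioi (1 : ℝ), (1 - z⁻¹) ^ n * z ^ (-(1 + c)) =
        n.factorial * Real.Gamma c / Real.Gamma (n + 1 + c) := by
  induction n generalizing c with
  | zero =>
    have hexp : -(1 + c) < -1 := by linarith
    refine ⟨by simpa using integrableOn_Ioi_rpow_of_lt hexp zero_lt_one, ?_⟩
    have hΓ := (Real.Gamma_pos_of_pos hc).ne'
    simp only [pow_zero, one_mul, integral_Ioi_rpow_of_lt hexp zero_lt_one, Real.one_rpow,
      Nat.factorial_zero, Nat.cast_one, Nat.cast_zero, zero_add]
    rw [add_comm 1 c, Real.Gamma_add_one hc.ne', show -(c + 1) + 1 = -c by ring]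
    field_simp
  | succ n ih =>
    obtain ⟨h₁, e₁⟩ := ih hc
    obtain ⟨h₂, e₂⟩ := ih (add_pos hc one_pos)
    have hsplit : Set.EqOn (fun z : ℝ => (1 - z⁻¹) ^ (n + 1) * z ^ (-(1 + c)))
        (fun z : ℝ => (1 - z⁻¹) ^ n * z ^ (-(1 + c)) - (1 - z⁻¹) ^ n * z ^ (-(1 + (c + 1))))
        (Set.Ioi 1) := by
      intro z hz
      have hz0 : (0 : ℝ) < z := zero_lt_one.trans hz
      have hpow : z ^ (-(1 + (c + 1))) = z ^ (-(1 + c)) * z⁻¹ := by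
        rw [← Real.rpow_neg_one z, ← Real.rpow_add hz0]
        congr 1
        ring
      simp only [hpow]
      ring
    refine ⟨(integrableOn_congr_fun hsplit measurableSet_Ioi).2 (h₁.sub h₂), ?_⟩
    rw [setIntegral_congr_fun measurableSet_Ioi hsplit, integral_sub h₁ h₂, e₁, e₂,
      Real.Gamma_add_one hc.ne', Nat.factorial_succ]
    have hn : (0 : ℝ) < n + 1 + c := by positivity
    have hΓ := (Real.Gamma_pos_of_pos hn).ne'
    rw [show (n : ℝ) + 1 + (c + 1) = n + 1 + c + 1 by ring]
    push_cast
    rw [show (n : ℝ) + 1 + 1 + c = n + 1 + c + 1 by ring, Real.Gamma_add_one hn.ne']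
    field_simp
    ring

theorem bcoef_zero_pos (k : ℕ) {δ : ℝ} (hδ : -1 < δ) : 0 < bcoef k δ 0 := by
  have : (0 : ℝ) ≤ k * (1 + δ) := mul_nonneg k.cast_nonneg (by linarith)
  simp only [bcoef, Nat.cast_zero]
  linarith

theorem tauc_pos (k : ℕ) {δ : ℝ} (hδ : -1 < δ) : 0 < tauc k δ := by
  have : (0 : ℝ) ≤ (k + 1) * (1 + δ) := mul_nonneg (by positivity) (by linarith)
  simp only [tauc]
  linarith

theorem a0c_pos (k : ℕ) {δ : ℝ} (hδ : -1 < δ) : 0 < a0c k δ :=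
  div_pos (mul_pos (by positivity) (by linarith)) (bcoef_zero_pos k hδ)

theorem bcoef_zero_mul_add_a0c (k : ℕ) {δ : ℝ} (hδ : -1 < δ) (x : ℝ) :
    bcoef k δ 0 * (x + a0c k δ) = (x + 1) * bcoef k δ 0 + δ := by
  rw [mul_add, a0c, mul_div_cancel₀ _ (bcoef_zero_pos k hδ).ne']
  simp only [bcoef, Nat.cast_zero]
  ring

theorem bcoef_zero_mul_add_a0c_add (k : ℕ) {δ : ℝ} (hδ : -1 < δ) (x : ℝ) :
    bcoef k δ 0 * (x + a0c k δ + tauc k δ / bcoef k δ 0) =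
      (x + 1) * bcoef k δ 0 + (k + 2) * (1 + δ) := by
  rw [mul_add, bcoef_zero_mul_add_a0c k hδ, mul_div_cancel₀ _ (bcoef_zero_pos k hδ).ne']
  simp only [bcoef, tauc, Nat.cast_zero]
  ring

theorem MarginalRec.eq_gamma_ratio {k : ℕ} {δ : ℝ} (hδ : -1 < δ) {q : ℕ → ℝ}
    (hq : MarginalRec k δ q) (n : ℕ) :
    q (k + 1 + n) = tauc k δ / bcoef k δ 0 *
      (Real.Gamma (a0c k δ + tauc k δ / bcoef k δ 0) / Real.Gamma (a0c k δ)) *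
      (Real.Gamma (n + a0c k δ) /
        Real.Gamma (n + 1 + a0c k δ + tauc k δ / bcoef k δ 0)) := by
  have hb := bcoef_zero_pos k hδ
  have ha := a0c_pos k hδ
  have hs : 0 < tauc k δ / bcoef k δ 0 := div_pos (tauc_pos k hδ) hb
  have hΓa := (Real.Gamma_pos_of_pos ha).ne'
  induction n with
  | zero =>
    have has : 0 < a0c k δ + tauc k δ / bcoef k δ 0 := add_pos ha hs
    have hΓ := (Real.Gamma_pos_of_pos has).ne'
    have hden := bcoef_zero_mul_add_a0c_add k hδ 0
    rw [zero_add, zero_add, one_mul] at hden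
    rw [add_zero, hq.2 (k + 1) le_rfl, Nat.add_sub_cancel, hq.1, if_pos rfl, ← hden,
      Nat.cast_zero, zero_add, zero_add,
      show 1 + a0c k δ + tauc k δ / bcoef k δ 0 = a0c k δ + tauc k δ / bcoef k δ 0 + 1 by ring,
      Real.Gamma_add_one has.ne', mul_zero, zero_add, mul_one]
    generalize a0c k δ + tauc k δ / bcoef k δ 0 = c at *
    field_simp
  | succ n ih =>
    have hna : 0 < (n : ℝ) + a0c k δ := by positivity
    have hnc : 0 < (n : ℝ) + 1 + a0c k δ + tauc k δ / bcoef k δ 0 := by positivity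
    have hΓc := (Real.Gamma_pos_of_pos hnc).ne'
    have hnum := bcoef_zero_mul_add_a0c k hδ n
    have hden := bcoef_zero_mul_add_a0c_add k hδ (n + 1)
    rw [hq.2 (k + 1 + (n + 1)) (by omega), if_neg (by omega), mul_zero, add_zero,
      show k + 1 + (n + 1) - 1 = k + 1 + n by omega, ih]
    push_cast
    rw [show (k : ℝ) + 1 + (n + 1) - k - 1 = n + 1 by ring,
      show (k : ℝ) + 1 + (n + 1) - k = n + 1 + 1 by ring, ← hnum, ← hden,
      show (n : ℝ) + 1 + a0c k δ = n + a0c k δ + 1 by ring, Real.Gamma_add_one hna.ne',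
      show (n : ℝ) + 1 + 1 + a0c k δ + tauc k δ / bcoef k δ 0 =
        n + 1 + a0c k δ + tauc k δ / bcoef k δ 0 + 1 by ring, Real.Gamma_add_one hnc.ne',
      show (n : ℝ) + a0c k δ + 1 = n + 1 + a0c k δ by ring]
    generalize (n : ℝ) + 1 + a0c k δ + tauc k δ / bcoef k δ 0 = c at *
    field_simp

/-- The solution of the marginal recursion is the pmf of `k + 1` plus a negative binomial
random variable with shape `a_0 = (k+1)(1+δ)/b_0` and random success probability `Z^{-1}`,
`Z` Pareto`(τ/b_0)`; explicitly,
`p̃^{(0)}_i = (τ/b_0)(Γ(a_0+τ/b_0)/Γ(a_0))(Γ(i-k-1+a_0)/Γ(i-k+a_0+τ/b_0))`. -/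
theorem marginal_pmf_is_mixed_negative_binomial (k : ℕ) (δ : ℝ) (hδ : -1 < δ)
    (q : ℕ → ℝ) (hq : MarginalRec k δ q) :
    ∀ i : ℕ, k + 1 ≤ i →
      ((Real.Gamma ((i : ℝ) - k - 1 + a0c k δ) /
          (((i - k - 1).factorial : ℝ) * Real.Gamma (a0c k δ))) *
        ∫ z in Set.Ioi (1 : ℝ),
          (1 - z⁻¹) ^ (i - k - 1) * z ^ (-(a0c k δ)) *
            (tauc k δ / bcoef k δ 0) * z ^ (-(1 + tauc k δ / bcoef k δ 0))) = q i ∧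
      q i = tauc k δ / bcoef k δ 0 *
          (Real.Gamma (a0c k δ + tauc k δ / bcoef k δ 0) / Real.Gamma (a0c k δ)) *
          (Real.Gamma ((i : ℝ) - k - 1 + a0c k δ) /
            Real.Gamma ((i : ℝ) - k + a0c k δ + tauc k δ / bcoef k δ 0)) := by
  intro i hi
  obtain ⟨n, rfl⟩ := Nat.exists_eq_add_of_le hi
  have ha := a0c_pos k hδ
  have hs : 0 < tauc k δ / bcoef k δ 0 := div_pos (tauc_pos k hδ) (bcoef_zero_pos k hδ)
  have hΓa := (Real.Gamma_pos_of_pos ha).ne'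
  have hcast : ((k + 1 + n : ℕ) : ℝ) - k = n + 1 := by push_cast; ring
  rw [hcast, add_sub_cancel_right, show k + 1 + n - k - 1 = n by omega, hq.eq_gamma_ratio hδ]
  refine ⟨?_, rfl⟩
  have hcombine : Set.EqOn (fun z : ℝ => (1 - z⁻¹) ^ n * z ^ (-(a0c k δ)) *
        (tauc k δ / bcoef k δ 0) * z ^ (-(1 + tauc k δ / bcoef k δ 0)))
      (fun z : ℝ => tauc k δ / bcoef k δ 0 *
        ((1 - z⁻¹) ^ n * z ^ (-(1 + (a0c k δ + tauc k δ / bcoef k δ 0))))) (Set.Ioi 1) := by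
    intro z hz
    have hz0 : (0 : ℝ) < z := zero_lt_one.trans hz
    have hpow : z ^ (-(1 + (a0c k δ + tauc k δ / bcoef k δ 0))) =
        z ^ (-(a0c k δ)) * z ^ (-(1 + tauc k δ / bcoef k δ 0)) := by
      rw [← Real.rpow_add hz0]
      congr 1
      ring
    simp only [hpow]
    ring
  rw [setIntegral_congr_fun measurableSet_Ioi hcombine, integral_const_mul,
    (integrableOn_and_integral_one_sub_inv_pow_mul_rpow n (add_pos ha hs)).2, ← add_assoc]
  have hfact : (n.factorial : ℝ) ≠ 0 := by positivity
  field_simp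
end
end
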